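/- arXiv:2007.00187 — 5 statements merged into one kernel-verified Lean document; each statement's English description precedes it below -/
import Mathlib

section
/- Let j ≥ 1 and s be integers with 0 ≤ s ≤ ⌊j/2⌋, let α ∈ (0, 1/2], and let p = (p_1,…,p_j) ∈ [0,1]^j satisfy p_l ≥ 1/2 + α for every l. Then f_p(j,s) ≤ C(j,s) · (1/2 + α)^s · (1/2 − α)^{j−s}, where C(j,s) is the binomial coefficient. -/
open Finset

/-- `f p j s` : probability that exactly `s` of `j` independent Bernoulli trials with
success probabilities `p 0, …, p (j-1)` succeed. -/
noncomputable def bernCount (j : ℕ) (p : Fin j → ℝ) (s : ℕ) : ℝ :=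
  ∑ B ∈ Finset.powersetCard s (Finset.univ : Finset (Fin j)),
    (∏ l ∈ B, p l) * ∏ l ∈ Bᶜ, (1 - p l)

section PoissonBinomial

variable {ι : Type*} [DecidableEq ι]

/-- The probability that, among independent trials indexed by `S` with success
probabilities `p`, exactly the trials in `B` succeed. -/
noncomputable def outcomeWeight (S : Finset ι) (p : ι → ℝ) (B : Finset ι) : ℝ :=
  (∏ l ∈ B, p l) * ∏ l ∈ S \ B, (1 - p l)

/-- The probability that exactly `s` of the independent trials indexed by `S` succeed. -/
noncomputable def successProb (S : Finset ι) (p : ι → ℝ) (s : ℕ) : ℝ :=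
  ∑ B ∈ S.powersetCard s, outcomeWeight S p B

lemma outcomeWeight_insert_of_notMem {S B : Finset ι} {i : ι} (p : ι → ℝ) (hi : i ∉ S)
    (hB : B ⊆ S) : outcomeWeight (insert i S) p B = (1 - p i) * outcomeWeight S p B := by
  have hiB : i ∉ B := fun h => hi (hB h)
  have hiSB : i ∉ S \ B := fun h => hi (mem_sdiff.1 h).1
  rw [outcomeWeight, outcomeWeight, insert_sdiff_of_notMem _ hiB, prod_insert hiSB]
  ring

lemma outcomeWeight_insert_insert {S B : Finset ι} {i : ι} (p : ι → ℝ) (hi : i ∉ S)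
    (hB : B ⊆ S) : outcomeWeight (insert i S) p (insert i B) = p i * outcomeWeight S p B := by
  have hiB : i ∉ B := fun h => hi (hB h)
  rw [outcomeWeight, outcomeWeight, prod_insert hiB, insert_sdiff_insert,
    sdiff_insert_of_notMem hi, mul_assoc]

lemma successProb_insert_zero {S : Finset ι} {i : ι} (p : ι → ℝ) (hi : i ∉ S) :
    successProb (insert i S) p 0 = (1 - p i) * successProb S p 0 := by
  simp [successProb, outcomeWeight_insert_of_notMem p hi (empty_subset S)]

lemma successProb_insert_succ {S : Finset ι} {i : ι} (p : ι → ℝ) (hi : i ∉ S) (s : ℕ) :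
    successProb (insert i S) p (s + 1) =
      p i * successProb S p s + (1 - p i) * successProb S p (s + 1) := by
  have hdisj : Disjoint (S.powersetCard (s + 1)) ((S.powersetCard s).image (insert i)) := by
    rw [disjoint_left]
    intro B hB hB'
    obtain ⟨C, -, rfl⟩ := mem_image.1 hB'
    exact hi ((mem_powersetCard.1 hB).1 (mem_insert_self i C))
  have hinj : Set.InjOn (insert i) (S.powersetCard s : Set (Finset ι)) := by
    intro B hB C hC h
    have hB' : i ∉ B := fun h => hi ((mem_powersetCard.1 (mem_coe.1 hB)).1 h)
    have hC' : i ∉ C := fun h => hi ((mem_powersetCard.1 (mem_coe.1 hC)).1 h)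
    rw [← erase_insert hB', ← erase_insert hC', h]
  rw [successProb, powersetCard_succ_insert hi, sum_union hdisj, sum_image hinj, add_comm,
    successProb, successProb, mul_sum, mul_sum]
  congr 1
  · exact sum_congr rfl fun B hB =>
      outcomeWeight_insert_insert p hi (mem_powersetCard.1 hB).1
  · exact sum_congr rfl fun B hB =>
      outcomeWeight_insert_of_notMem p hi (mem_powersetCard.1 hB).1

lemma successProb_congr {S : Finset ι} {p q : ι → ℝ} (h : ∀ l ∈ S, p l = q l) (s : ℕ) :
    successProb S p s = successProb S q s := by
  refine sum_congr rfl fun B hB => ?_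
  have hBS := (mem_powersetCard.1 hB).1
  exact congrArg₂ (· * ·) (prod_congr rfl fun l hl => h l (hBS hl))
    (prod_congr rfl fun l hl => by rw [h l (mem_sdiff.1 hl).1])

lemma successProb_const (S : Finset ι) (a : ℝ) (s : ℕ) :
    successProb S (fun _ => a) s = (S.card.choose s : ℝ) * a ^ s * (1 - a) ^ (S.card - s) := by
  rw [successProb, sum_congr rfl (g := fun _ => a ^ s * (1 - a) ^ (S.card - s))]
  · rw [sum_const, card_powersetCard, nsmul_eq_mul, mul_assoc]
  · intro B hB
    obtain ⟨hBS, hBs⟩ := mem_powersetCard.1 hB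
    rw [outcomeWeight, prod_const, prod_const, card_sdiff_of_subset hBS, hBs]

lemma outcomeWeight_nonneg {S B : Finset ι} {p : ι → ℝ} (h0 : ∀ l ∈ S, 0 ≤ p l)
    (h1 : ∀ l ∈ S, p l ≤ 1) (hB : B ⊆ S) : 0 ≤ outcomeWeight S p B :=
  mul_nonneg (prod_nonneg fun l hl => h0 l (hB hl))
    (prod_nonneg fun l hl => sub_nonneg.2 (h1 l (mem_sdiff.1 hl).1))

/-- Turning one failure into a success does not decrease the weight of an outcome when all
success probabilities are at least `1 / 2`. -/
lemma outcomeWeight_le_insert {S B : Finset ι} {p : ι → ℝ} {l : ι}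
    (hhalf : ∀ l ∈ S, 1 / 2 ≤ p l) (h1 : ∀ l ∈ S, p l ≤ 1) (hB : B ⊆ S) (hl : l ∈ S \ B) :
    outcomeWeight S p B ≤ outcomeWeight S p (insert l B) := by
  obtain ⟨hlS, hlB⟩ := mem_sdiff.1 hl
  have hBe : B ⊆ S.erase l := subset_erase.2 ⟨hB, hlB⟩
  have hw : 0 ≤ outcomeWeight (S.erase l) p B :=
    outcomeWeight_nonneg (fun k hk => by linarith [hhalf k (mem_of_mem_erase hk)])
      (fun k hk => h1 k (mem_of_mem_erase hk)) hBe
  rw [← insert_erase hlS, outcomeWeight_insert_of_notMem p (notMem_erase l S) hBe,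
    outcomeWeight_insert_insert p (notMem_erase l S) hBe]
  exact mul_le_mul_of_nonneg_right (by linarith [hhalf l hlS]) hw

/-- Double counting of pairs consisting of a set of size `s + 1` and one of its elements. -/
lemma succ_mul_successProb_succ (S : Finset ι) (p : ι → ℝ) (s : ℕ) :
    ((s : ℝ) + 1) * successProb S p (s + 1) =
      ∑ B ∈ S.powersetCard s, ∑ l ∈ S \ B, outcomeWeight S p (insert l B) := by
  have h : ((s : ℝ) + 1) * successProb S p (s + 1) =
      ∑ B ∈ S.powersetCard (s + 1), ∑ _l ∈ B, outcomeWeight S p B := by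
    rw [successProb, mul_sum]
    refine sum_congr rfl fun B hB => ?_
    rw [sum_const, (mem_powersetCard.1 hB).2, nsmul_eq_mul]
    push_cast
    rfl
  rw [h, sum_sigma', sum_sigma']
  refine sum_bij' (fun x _ => ⟨x.1.erase x.2, x.2⟩) (fun x _ => ⟨insert x.2 x.1, x.2⟩)
    ?_ ?_ ?_ ?_ ?_
  · rintro ⟨B, l⟩ hx
    simp only [mem_sigma, mem_powersetCard, mem_sdiff] at hx ⊢
    obtain ⟨⟨hBS, hBs⟩, hl⟩ := hx
    exact ⟨⟨(erase_subset l B).trans hBS, by rw [card_erase_of_mem hl, hBs]; rfl⟩,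
      hBS hl, notMem_erase l B⟩
  · rintro ⟨B, l⟩ hx
    simp only [mem_sigma, mem_powersetCard, mem_sdiff] at hx ⊢
    obtain ⟨⟨hBS, hBs⟩, hlS, hlB⟩ := hx
    exact ⟨⟨insert_subset hlS hBS, by rw [card_insert_of_notMem hlB, hBs]⟩,
      mem_insert_self l B⟩
  · rintro ⟨B, l⟩ hx
    simp [insert_erase (mem_sigma.1 hx).2]
  · rintro ⟨B, l⟩ hx
    simp [erase_insert (mem_sdiff.1 (mem_sigma.1 hx).2).2]
  · rintro ⟨B, l⟩ hx
    simp [insert_erase (mem_sigma.1 hx).2]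

lemma successProb_le_succ {S : Finset ι} {p : ι → ℝ} {s : ℕ} (hs : 2 * s + 1 ≤ S.card)
    (hhalf : ∀ l ∈ S, 1 / 2 ≤ p l) (h1 : ∀ l ∈ S, p l ≤ 1) :
    successProb S p s ≤ successProb S p (s + 1) := by
  have h0 : ∀ l ∈ S, 0 ≤ p l := fun l hl => by linarith [hhalf l hl]
  have key : ((s : ℝ) + 1) * successProb S p s ≤ ((s : ℝ) + 1) * successProb S p (s + 1) := by
    rw [succ_mul_successProb_succ, successProb, mul_sum]
    refine sum_le_sum fun B hB => ?_
    obtain ⟨hBS, hBs⟩ := mem_powersetCard.1 hB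
    have hcard : s + 1 ≤ (S \ B).card := by
      rw [card_sdiff_of_subset hBS, hBs]
      omega
    calc ((s : ℝ) + 1) * outcomeWeight S p B
        ≤ ((S \ B).card : ℝ) * outcomeWeight S p B :=
          mul_le_mul_of_nonneg_right (by exact_mod_cast hcard)
            (outcomeWeight_nonneg h0 h1 hBS)
      _ = ∑ _l ∈ S \ B, outcomeWeight S p B := by rw [sum_const, nsmul_eq_mul]
      _ ≤ ∑ l ∈ S \ B, outcomeWeight S p (insert l B) :=
          sum_le_sum fun l hl => outcomeWeight_le_insert hhalf h1 hBS hl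
  exact le_of_mul_le_mul_left key (by positivity)

/-- Lowering a single success probability increases the probability of exactly `s`
successes, for `s` at most half the number of trials. -/
lemma successProb_le_update {S : Finset ι} {p : ι → ℝ} {s : ℕ} {i : ι} {a : ℝ} (hi : i ∈ S)
    (hs : 2 * s ≤ S.card) (hhalf : ∀ l ∈ S, 1 / 2 ≤ p l) (h1 : ∀ l ∈ S, p l ≤ 1)
    (ha : a ≤ p i) : successProb S p s ≤ successProb S (Function.update p i a) s := by
  have hcongr (t : ℕ) :
      successProb (S.erase i) (Function.update p i a) t = successProb (S.erase i) p t :=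
    successProb_congr (fun l hl => Function.update_of_ne (ne_of_mem_erase hl) a p) t
  have hcard := card_erase_add_one hi
  have hhalf' : ∀ l ∈ S.erase i, 1 / 2 ≤ p l := fun l hl => hhalf l (mem_of_mem_erase hl)
  have h1' : ∀ l ∈ S.erase i, p l ≤ 1 := fun l hl => h1 l (mem_of_mem_erase hl)
  rw [← insert_erase hi]
  cases s with
  | zero =>
    rw [successProb_insert_zero p (notMem_erase i S),
      successProb_insert_zero _ (notMem_erase i S), hcongr, Function.update_self]
    refine mul_le_mul_of_nonneg_right (by linarith) (sum_nonneg fun B hB => ?_)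
    exact outcomeWeight_nonneg (fun l hl => by linarith [hhalf' l hl]) h1'
      (mem_powersetCard.1 hB).1
  | succ s =>
    have hmode : successProb (S.erase i) p s ≤ successProb (S.erase i) p (s + 1) :=
      successProb_le_succ (by omega) hhalf' h1'
    rw [successProb_insert_succ p (notMem_erase i S),
      successProb_insert_succ _ (notMem_erase i S), hcongr, hcongr, Function.update_self]
    nlinarith [mul_nonneg (sub_nonneg.2 ha) (sub_nonneg.2 hmode)]

lemma successProb_le_const {S : Finset ι} {p : ι → ℝ} {s : ℕ} {a : ℝ} (hs : 2 * s ≤ S.card)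
    (hhalf : 1 / 2 ≤ a) (ha : ∀ l ∈ S, a ≤ p l) (h1 : ∀ l ∈ S, p l ≤ 1) :
    successProb S p s ≤ successProb S (fun _ => a) s := by
  have key : ∀ T ⊆ S, successProb S p s ≤ successProb S (T.piecewise (fun _ => a) p) s := by
    intro T
    induction T using Finset.induction_on with
    | empty => simp
    | insert i T hiT ih =>
      intro hT
      have hi : i ∈ S := hT (mem_insert_self i T)
      refine (ih fun l hl => hT (mem_insert_of_mem hl)).trans ?_
      rw [piecewise_insert]
      refine successProb_le_update hi hs (fun l hl => ?_) (fun l hl => ?_) ?_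
      · by_cases hlT : l ∈ T
        · simpa [hlT] using hhalf
        · simpa [hlT] using hhalf.trans (ha l hl)
      · by_cases hlT : l ∈ T
        · simpa [hlT] using (ha l hl).trans (h1 l hl)
        · simpa [hlT] using h1 l hl
      · simpa [hiT] using ha i hi
  exact (key S subset_rfl).trans_eq
    (successProb_congr (fun l hl => piecewise_eq_of_mem _ _ _ hl) s)

end PoissonBinomial

theorem stmt_0 (j s : ℕ) (hj : 1 ≤ j) (hs : s ≤ j / 2)
    (α : ℝ) (hα0 : 0 < α) (hα : α ≤ 1 / 2)
    (p : Fin j → ℝ) (hp0 : ∀ l, 0 ≤ p l) (hp1 : ∀ l, p l ≤ 1)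
    (hp : ∀ l, 1 / 2 + α ≤ p l) :
    bernCount j p s ≤ (j.choose s : ℝ) * (1 / 2 + α) ^ s * (1 / 2 - α) ^ (j - s) := by
  have h := successProb_le_const (S := Finset.univ) (p := p) (s := s)
    (by rw [card_univ, Fintype.card_fin]; omega) (by linarith : 1 / 2 ≤ 1 / 2 + α)
    (fun l _ => hp l) (fun l _ => hp1 l)
  rw [successProb_const, card_univ, Fintype.card_fin,
    show 1 - (1 / 2 + α) = 1 / 2 - α by ring] at h
  simpa only [successProb, outcomeWeight, bernCount, compl_eq_univ_sdiff] using h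
end

section
/- For every integer j ≥ 0, every α ∈ (0, 1/2], and every p = (p_1,…,p_j) ∈ [0,1]^j with p_l ≥ 1/2 + α for all l, one has Σ_{s=0}^{j} f_p(j,s) / F_{j+1,1/2}(s) ≤ 4 + 1/α. -/
open Finset

/-- CDF of the Binomial(n, q) distribution at `s`. -/
noncomputable def binCDF (n : ℕ) (q : ℝ) (s : ℕ) : ℝ :=
  ∑ k ∈ Finset.range (s + 1), (n.choose k : ℝ) * q ^ k * (1 - q) ^ (n - k)

lemma binCDF_half (n s : ℕ) :
    binCDF n (1 / 2) s = (∑ k ∈ Finset.range (s + 1), (n.choose k : ℝ)) / 2 ^ n := by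
  rw [binCDF, Finset.sum_div]
  refine Finset.sum_congr rfl fun k _ => ?_
  rcases le_or_gt k n with hk | hk
  · have h : ((1 : ℝ) - 1 / 2) = 1 / 2 := by norm_num
    rw [h, mul_assoc, ← pow_add, Nat.add_sub_cancel' hk, one_div, inv_pow, div_eq_mul_inv]
  · simp [Nat.choose_eq_zero_of_lt hk]

lemma binCDF_half_pos (n s : ℕ) : 0 < binCDF n (1 / 2) s := by
  rw [binCDF_half]
  refine div_pos (Finset.sum_pos' (fun _ _ => by positivity) ⟨0, by simp, by simp⟩) (by positivity)

lemma binCDF_half_mono (n : ℕ) : Monotone (binCDF n (1 / 2)) := by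
  refine monotone_nat_of_le_succ fun s => ?_
  simp only [binCDF_half]
  refine div_le_div_of_nonneg_right ?_ (by positivity)
  exact Finset.sum_le_sum_of_subset_of_nonneg (Finset.range_mono (by omega))
    fun _ _ _ => by positivity

lemma sum_range_choose_succ_le (n s : ℕ) :
    ∑ k ∈ Finset.range (s + 1), (n + 1).choose k
      ≤ 2 * ∑ k ∈ Finset.range (s + 1), n.choose k := by
  have h : ∑ k ∈ Finset.range (s + 1), (n + 1).choose k
      = ∑ k ∈ Finset.range s, n.choose k + ∑ k ∈ Finset.range (s + 1), n.choose k := by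
    rw [Finset.sum_range_succ', Finset.sum_range_succ' (fun k => n.choose k) s]
    simp only [Nat.choose_succ_succ', Finset.sum_add_distrib, Nat.choose_zero_right]
    ring
  have h' : ∑ k ∈ Finset.range s, n.choose k ≤ ∑ k ∈ Finset.range (s + 1), n.choose k :=
    Finset.sum_le_sum_of_subset (Finset.range_mono (by omega))
  omega

lemma binCDF_half_antitone (s : ℕ) : Antitone fun n => binCDF n (1 / 2) s := by
  refine antitone_nat_of_succ_le fun n => ?_
  simp only [binCDF_half]
  rw [div_le_div_iff₀ (by positivity) (by positivity)]
  have h : (∑ k ∈ Finset.range (s + 1), ((n + 1).choose k : ℝ))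
      ≤ 2 * ∑ k ∈ Finset.range (s + 1), (n.choose k : ℝ) := by
    exact_mod_cast sum_range_choose_succ_le n s
  have := mul_le_mul_of_nonneg_right h (by positivity : (0 : ℝ) ≤ 2 ^ n)
  rw [pow_succ]
  linarith

lemma half_le_binCDF_half {n s : ℕ} (h : n ≤ 2 * s + 1) : 1 / 2 ≤ binCDF n (1 / 2) s := by
  refine le_trans (le_of_eq ?_) (binCDF_half_antitone s h)
  have h4 : (∑ k ∈ Finset.range (s + 1), ((2 * s + 1).choose k : ℝ)) = 4 ^ s := by
    exact_mod_cast Nat.sum_range_choose_halfway s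
  simp only [binCDF_half]
  rw [h4, pow_succ, pow_mul]
  norm_num
  field_simp

lemma choose_div_le_binCDF_half (j s : ℕ) :
    (j.choose s : ℝ) / 2 ^ (j + 1) ≤ binCDF (j + 1) (1 / 2) s := by
  rw [binCDF_half]
  gcongr
  refine le_trans ?_ (Finset.single_le_sum (f := fun k => ((j + 1).choose k : ℝ))
    (fun _ _ => by positivity) (Finset.self_mem_range_succ s))
  exact_mod_cast Nat.choose_le_choose s (Nat.le_succ j)

/-- The expectation of `g` of the number of successes among independent trials indexed by `S`. -/
noncomputable def bernExpect {ι : Type*} [DecidableEq ι] (S : Finset ι) (p : ι → ℝ)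
    (g : ℕ → ℝ) : ℝ :=
  ∑ B ∈ S.powerset, (∏ l ∈ B, p l) * (∏ l ∈ S \ B, (1 - p l)) * g B.card

section bernExpect

variable {ι : Type*} [DecidableEq ι]

lemma bernExpect_insert {S : Finset ι} {a : ι} (ha : a ∉ S) (p : ι → ℝ) (g : ℕ → ℝ) :
    bernExpect (insert a S) p g
      = p a * bernExpect S p (fun s => g (s + 1)) + (1 - p a) * bernExpect S p g := by
  rw [bernExpect, Finset.sum_powerset_insert ha, add_comm, bernExpect, bernExpect,
    Finset.mul_sum, Finset.mul_sum]
  congr 1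
  · refine Finset.sum_congr rfl fun B hB => ?_
    have hB' := Finset.mem_powerset.1 hB
    have haB : a ∉ B := fun h => ha (hB' h)
    have hs : insert a S \ insert a B = S \ B := by grind
    rw [hs, Finset.prod_insert haB, Finset.card_insert_of_notMem haB]
    ring
  · refine Finset.sum_congr rfl fun B hB => ?_
    have haB : a ∉ B := fun h => ha (Finset.mem_powerset.1 hB h)
    rw [Finset.insert_sdiff_of_notMem _ haB, Finset.prod_insert (by simp [ha])]
    ring

lemma bernExpect_mono {S : Finset ι} {p : ι → ℝ} (hp0 : ∀ l, 0 ≤ p l) (hp1 : ∀ l, p l ≤ 1)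
    {g h : ℕ → ℝ} (hgh : ∀ s, g s ≤ h s) : bernExpect S p g ≤ bernExpect S p h := by
  refine Finset.sum_le_sum fun B _ => mul_le_mul_of_nonneg_left (hgh _) (mul_nonneg ?_ ?_)
  · exact Finset.prod_nonneg fun l _ => hp0 l
  · exact Finset.prod_nonneg fun l _ => sub_nonneg.2 (hp1 l)

lemma bernExpect_le_of_le {p r : ι → ℝ} (hp1 : ∀ l, p l ≤ 1) (hr0 : ∀ l, 0 ≤ r l)
    (hrp : ∀ l, r l ≤ p l) (S : Finset ι) {g : ℕ → ℝ} (hg : Antitone g) :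
    bernExpect S p g ≤ bernExpect S r g := by
  induction S using Finset.induction_on generalizing g with
  | empty => simp [bernExpect]
  | insert a S ha ih =>
    rw [bernExpect_insert ha, bernExpect_insert ha]
    have hg' : Antitone fun s => g (s + 1) := fun x y h => hg (by omega)
    have h1 := mul_le_mul_of_nonneg_left (ih hg') ((hr0 a).trans (hrp a))
    have h2 := mul_le_mul_of_nonneg_left (ih hg) (sub_nonneg.2 (hp1 a))
    have h3 : bernExpect S r (fun s => g (s + 1)) ≤ bernExpect S r g :=
      bernExpect_mono hr0 (fun l => (hrp l).trans (hp1 l)) fun s => hg (Nat.le_succ s)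
    nlinarith [mul_nonneg (sub_nonneg.2 (hrp a)) (sub_nonneg.2 h3)]

lemma bernExpect_const (S : Finset ι) (c : ℝ) (g : ℕ → ℝ) :
    bernExpect S (fun _ => c) g = ∑ s ∈ Finset.range (S.card + 1),
      (S.card.choose s : ℝ) * c ^ s * (1 - c) ^ (S.card - s) * g s := by
  rw [bernExpect, Finset.sum_powerset]
  refine Finset.sum_congr rfl fun s _ => ?_
  rw [← Finset.card_powersetCard, mul_assoc, mul_assoc, ← nsmul_eq_mul, ← Finset.sum_const]
  refine Finset.sum_congr rfl fun B hB => ?_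
  obtain ⟨hBS, hB⟩ := Finset.mem_powersetCard.1 hB
  rw [Finset.prod_const, Finset.prod_const, Finset.card_sdiff_of_subset hBS, hB, mul_assoc]

end bernExpect

lemma sum_bernCount_mul (j : ℕ) (p : Fin j → ℝ) (g : ℕ → ℝ) :
    ∑ s ∈ Finset.range (j + 1), bernCount j p s * g s = bernExpect Finset.univ p g := by
  rw [bernExpect, Finset.sum_powerset, Finset.card_univ, Fintype.card_fin]
  refine Finset.sum_congr rfl fun s _ => ?_
  rw [bernCount, Finset.sum_mul]
  refine Finset.sum_congr rfl fun B hB => ?_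
  rw [(Finset.mem_powersetCard.1 hB).2, Finset.compl_eq_univ_sdiff]

lemma choose_mul_div_binCDF_half_le (j s : ℕ) {x : ℝ} (hx : 0 ≤ x) :
    j.choose s * x * (binCDF (j + 1) (1 / 2) s)⁻¹
      ≤ 2 * (j.choose s * x) + if 2 * s < j then 2 ^ (j + 1) * x else 0 := by
  rw [← div_eq_mul_inv, div_le_iff₀ (binCDF_half_pos _ _)]
  have hF := binCDF_half_pos (j + 1) s
  split_ifs with hs
  · have h := choose_div_le_binCDF_half j s
    rw [div_le_iff₀ (by positivity)] at h
    have h1 := mul_le_mul_of_nonneg_right h hx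
    have h2 : 0 ≤ 2 * (j.choose s * x) * binCDF (j + 1) (1 / 2) s := by positivity
    linarith
  · have h := half_le_binCDF_half (n := j + 1) (s := s) (by omega)
    nlinarith [mul_le_mul_of_nonneg_left h (by positivity : 0 ≤ 2 * (j.choose s * x))]

lemma two_pow_mul_sum_lt_half_le (j : ℕ) {α : ℝ} (hα0 : 0 < α) (hα : α ≤ 1 / 2) :
    ∑ s ∈ Finset.range (j + 1), (if 2 * s < j then
      2 ^ (j + 1) * ((1 / 2 + α) ^ s * (1 - (1 / 2 + α)) ^ (j - s)) else 0) ≤ 1 / (2 * α) := by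
  set c := 1 / 2 + α with hc
  set d := 1 - c with hd
  have hd0 : 0 ≤ d := by linarith
  have hd2 : 2 * d ≤ 1 := by linarith
  have hc0 : 0 ≤ c := by linarith
  have hcd : 2 * c * (2 * d) ≤ 1 := by nlinarith [sq_nonneg (c - d)]
  obtain ⟨M, a, hMj, hMa, hMs⟩ : ∃ M a : ℕ, j + 1 = M + (M + (a - M)) ∧ M ≤ a ∧
      ∀ s, 2 * s < j ↔ s < M :=
    ⟨(j + 1) / 2, j + 1 - (j + 1) / 2, by omega, by omega, fun s => by omega⟩
  have hsum : ∑ s ∈ Finset.range (j + 1), (if 2 * s < j then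
      2 ^ (j + 1) * (c ^ s * d ^ (j - s)) else 0)
      = 2 ^ (j + 1) * d ^ a * ∑ s ∈ Finset.range M, c ^ s * d ^ (M - 1 - s) := by
    rw [← Finset.sum_filter, Finset.mul_sum]
    have : {s ∈ Finset.range (j + 1) | 2 * s < j} = Finset.range M := by
      ext s
      simp only [Finset.mem_filter, Finset.mem_range, hMs]
      omega
    rw [this]
    refine Finset.sum_congr rfl fun s hs => ?_
    have hs' := Finset.mem_range.1 hs
    have : j - s = a + (M - 1 - s) := by omega
    rw [this, pow_add]
    ring
  have hgeom := (Commute.all c d).geom_sum₂_mul M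
  rw [hsum, le_div_iff₀ (by positivity)]
  have hcd' : c - d = 2 * α := by rw [hd, hc]; ring
  rw [mul_assoc, ← hcd', hgeom]
  calc 2 ^ (j + 1) * d ^ a * (c ^ M - d ^ M)
      ≤ 2 ^ (j + 1) * d ^ a * c ^ M := by
        gcongr
        linarith [pow_nonneg hd0 M]
    _ = (2 * c * (2 * d)) ^ M * (2 * d) ^ (a - M) := by
        have ha : d ^ a = d ^ M * d ^ (a - M) := by rw [← pow_add, Nat.add_sub_cancel' hMa]
        rw [ha, hMj]
        simp only [mul_pow, pow_add]
        ring
    _ ≤ 1 := mul_le_one₀ (pow_le_one₀ (by positivity) hcd) (by positivity)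
        (pow_le_one₀ (by positivity) hd2)

theorem stmt_2 (j : ℕ) (α : ℝ) (hα0 : 0 < α) (hα : α ≤ 1 / 2)
    (p : Fin j → ℝ) (hp0 : ∀ l, 0 ≤ p l) (hp1 : ∀ l, p l ≤ 1)
    (hp : ∀ l, 1 / 2 + α ≤ p l) :
    ∑ s ∈ Finset.range (j + 1), bernCount j p s / binCDF (j + 1) (1 / 2) s
      ≤ 4 + 1 / α := by
  have hanti : Antitone fun s => (binCDF (j + 1) (1 / 2) s)⁻¹ := fun s t h =>
    inv_anti₀ (binCDF_half_pos _ _) (binCDF_half_mono _ h)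
  have hc0 : 0 ≤ 1 / 2 + α := by positivity
  have hd0 : 0 ≤ 1 - (1 / 2 + α) := by linarith
  have hbinom : ∑ s ∈ Finset.range (j + 1),
      (j.choose s : ℝ) * ((1 / 2 + α) ^ s * (1 - (1 / 2 + α)) ^ (j - s)) = 1 := by
    have h := add_pow (1 / 2 + α) (1 - (1 / 2 + α)) j
    rw [add_sub_cancel, one_pow] at h
    exact (Finset.sum_congr rfl fun s _ => by ring).trans h.symm
  have hα2 : 1 / (2 * α) ≤ 1 / α := one_div_le_one_div_of_le hα0 (by linarith)
  simp only [div_eq_mul_inv (bernCount j p _)]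
  rw [sum_bernCount_mul j p fun s => (binCDF (j + 1) (1 / 2) s)⁻¹]
  refine (bernExpect_le_of_le hp1 (fun _ => hc0) hp _ hanti).trans ?_
  rw [bernExpect_const, Finset.card_univ, Fintype.card_fin]
  simp only [mul_assoc (Nat.cast (R := ℝ) (j.choose _)) (_ ^ _) (_ ^ _)]
  refine (Finset.sum_le_sum fun s _ => choose_mul_div_binCDF_half_le j s
    (by positivity : 0 ≤ (1 / 2 + α) ^ s * (1 - (1 / 2 + α)) ^ (j - s))).trans ?_
  rw [Finset.sum_add_distrib, ← Finset.mul_sum, hbinom]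
  linarith [two_pow_mul_sum_lt_half_le j hα0 hα]
end

section
/- For every α ∈ (0, 1/2], every integer j ≥ 8/α, and every p = (p_1,…,p_j) ∈ [0,1]^j, one has Σ_{s=⌈(1+α)j/2⌉}^{j} f_p(j,s) / F_{j+1,1/2}(s) ≤ 1 + 1/(exp(α²j/4) − 1). -/
open Finset

theorem bernCount_nonneg {j : ℕ} {p : Fin j → ℝ} (hp0 : ∀ l, 0 ≤ p l) (hp1 : ∀ l, p l ≤ 1)
    (s : ℕ) : 0 ≤ bernCount j p s :=
  sum_nonneg fun _ _ ↦ mul_nonneg (prod_nonneg fun l _ ↦ hp0 l)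
    (prod_nonneg fun l _ ↦ sub_nonneg.2 (hp1 l))

theorem sum_bernCount (j : ℕ) (p : Fin j → ℝ) :
    ∑ s ∈ range (j + 1), bernCount j p s = 1 := by
  have h := Finset.prod_add p (fun l ↦ 1 - p l) univ
  rw [Finset.sum_powerset] at h
  simpa [bernCount, compl_eq_univ_sdiff] using h.symm

theorem sum_Icc_bernCount_le_one {j : ℕ} {p : Fin j → ℝ} (hp0 : ∀ l, 0 ≤ p l)
    (hp1 : ∀ l, p l ≤ 1) (m : ℕ) : ∑ s ∈ Icc m j, bernCount j p s ≤ 1 := by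
  rw [← sum_bernCount j p]
  refine sum_le_sum_of_subset_of_nonneg (fun s hs ↦ ?_) fun s _ _ ↦ bernCount_nonneg hp0 hp1 s
  simp only [mem_Icc, mem_range] at hs ⊢
  omega

/-- Chernoff bound for the upper tail of the symmetric binomial distribution. -/
theorem one_sub_exp_le_binCDF_half {n s : ℕ} (hs : s ≤ n) {t : ℝ} (ht : 0 ≤ t) :
    1 - Real.exp (-t * (s + 1) + n * (t / 2 + t ^ 2 / 8)) ≤ binCDF n (1 / 2) s := by
  set w : ℕ → ℝ := fun k ↦ (n.choose k : ℝ) * (1 / 2) ^ k * (1 - 1 / 2) ^ (n - k) with hw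
  have hw0 (k : ℕ) : 0 ≤ w k := by
    simp only [hw]
    norm_num
  have total : ∑ k ∈ range (n + 1), w k = 1 := by
    have h := add_pow (1 / 2 : ℝ) (1 - 1 / 2) n
    rw [add_sub_cancel, one_pow] at h
    rw [h]
    exact sum_congr rfl fun k _ ↦ by simp only [hw]; ring
  have mgf : ∑ k ∈ range (n + 1), w k * Real.exp (t * k) = ((Real.exp t + 1) / 2) ^ n := by
    have h := add_pow (Real.exp t * (1 / 2)) (1 - 1 / 2) n
    rw [show (Real.exp t + 1) / 2 = Real.exp t * (1 / 2) + (1 - 1 / 2) by ring, h]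
    refine sum_congr rfl fun k _ ↦ ?_
    rw [mul_comm t, Real.exp_nat_mul, mul_pow]
    simp only [hw]
    ring
  have hcosh : (Real.exp t + 1) / 2 ≤ Real.exp (t / 2 + t ^ 2 / 8) := by
    have h := Real.cosh_le_exp_half_sq (t / 2)
    have e : (Real.exp t + 1) / 2 = Real.exp (t / 2) * Real.cosh (t / 2) := by
      rw [Real.cosh_eq, mul_div_assoc', mul_add, ← Real.exp_add, ← Real.exp_add]
      simp
    rw [e, Real.exp_add]
    gcongr
    exact h.trans_eq (by ring_nf)
  have tail : ∑ k ∈ Ico (s + 1) (n + 1), w k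
      ≤ Real.exp (-t * (s + 1) + n * (t / 2 + t ^ 2 / 8)) :=
    calc ∑ k ∈ Ico (s + 1) (n + 1), w k
        ≤ ∑ k ∈ Ico (s + 1) (n + 1), Real.exp (-t * (s + 1)) * (w k * Real.exp (t * k)) := by
          refine sum_le_sum fun k hk ↦ ?_
          have hk' : (s : ℝ) + 1 ≤ k := by exact_mod_cast (mem_Ico.1 hk).1
          rw [mul_left_comm, ← Real.exp_add]
          refine le_mul_of_one_le_right (hw0 k) (Real.one_le_exp ?_)
          nlinarith
      _ ≤ ∑ k ∈ range (n + 1), Real.exp (-t * (s + 1)) * (w k * Real.exp (t * k)) := by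
          refine sum_le_sum_of_subset_of_nonneg (fun k hk ↦ mem_range.2 (mem_Ico.1 hk).2)
            fun k _ _ ↦ ?_
          have := hw0 k
          positivity
      _ = Real.exp (-t * (s + 1)) * ((Real.exp t + 1) / 2) ^ n := by rw [← mul_sum, mgf]
      _ ≤ Real.exp (-t * (s + 1)) * Real.exp (t / 2 + t ^ 2 / 8) ^ n := by gcongr
      _ = _ := by rw [← Real.exp_nat_mul, ← Real.exp_add]
  have split := sum_range_add_sum_Ico w (Nat.succ_le_succ hs)
  rw [total] at split
  change _ ≤ ∑ k ∈ range (s + 1), w k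
  linarith

theorem stmt_8 (α : ℝ) (hα0 : 0 < α) (hα : α ≤ 1 / 2)
    (j : ℕ) (hj : 8 / α ≤ (j : ℝ))
    (p : Fin j → ℝ) (hp0 : ∀ l, 0 ≤ p l) (hp1 : ∀ l, p l ≤ 1) :
    ∑ s ∈ Finset.Icc ⌈(1 + α) * (j : ℝ) / 2⌉₊ j,
        bernCount j p s / binCDF (j + 1) (1 / 2) s
      ≤ 1 + 1 / (Real.exp (α ^ 2 * j / 4) - 1) := by
  have hj0 : (0 : ℝ) < j := lt_of_lt_of_le (by positivity) hj
  have hexp : 1 < Real.exp (α ^ 2 * j / 4) := Real.one_lt_exp_iff.2 (by positivity)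
  have hpos : 0 < 1 - Real.exp (-(α ^ 2 * j / 4)) :=
    sub_pos.2 (Real.exp_lt_one_iff.2 (neg_neg_of_pos (by positivity)))
  have hcdf (s : ℕ) (hs : s ∈ Icc ⌈(1 + α) * (j : ℝ) / 2⌉₊ j) :
      1 - Real.exp (-(α ^ 2 * j / 4)) ≤ binCDF (j + 1) (1 / 2) s := by
    obtain ⟨hs1, hs2⟩ := mem_Icc.1 hs
    have hs1' := Nat.ceil_le.1 hs1
    refine le_trans ?_ (one_sub_exp_le_binCDF_half (hs2.trans j.le_succ) hα0.le)
    gcongr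
    push_cast
    nlinarith [mul_le_mul_of_nonneg_left hs1' hα0.le, mul_pos (pow_pos hα0 2) hj0]
  calc ∑ s ∈ Icc ⌈(1 + α) * (j : ℝ) / 2⌉₊ j, bernCount j p s / binCDF (j + 1) (1 / 2) s
      ≤ ∑ s ∈ Icc ⌈(1 + α) * (j : ℝ) / 2⌉₊ j,
          bernCount j p s / (1 - Real.exp (-(α ^ 2 * j / 4))) :=
        sum_le_sum fun s hs ↦
          div_le_div_of_nonneg_left (bernCount_nonneg hp0 hp1 s) hpos (hcdf s hs)
    _ ≤ 1 / (1 - Real.exp (-(α ^ 2 * j / 4))) := by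
        rw [← sum_div]
        gcongr
        exact sum_Icc_bernCount_le_one hp0 hp1 _
    _ = 1 + 1 / (Real.exp (α ^ 2 * j / 4) - 1) := by
        rw [Real.exp_neg] at hpos ⊢
        have h1 := (sub_pos.2 hexp).ne'
        have h2 := hpos.ne'
        field_simp
        ring
end

section
/- For every α ∈ (0, 1/2], one has Σ_{j=⌈8/α⌉+1}^{∞} 1/(exp(j·α²/4) − 1) ≤ (8/α²) · 1/(exp(2α) − 1) + exp(−1) / (1 − exp(−α²/8)). -/
theorem one_div_exp_sub_one_le_exp_neg_half {x : ℝ} (hx : 2 ≤ x) :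
    1 / (Real.exp x - 1) ≤ Real.exp (-(x / 2)) := by
  have hy : 2 ≤ Real.exp (x / 2) := by linarith [Real.add_one_le_exp (x / 2)]
  have hsq : Real.exp x = Real.exp (x / 2) * Real.exp (x / 2) := by
    rw [← Real.exp_add, add_halves]
  rw [Real.exp_neg, ← one_div]
  apply one_div_le_one_div_of_le (by linarith)
  nlinarith

theorem stmt_13 (α : ℝ) (hα0 : 0 < α) (hα : α ≤ 1 / 2) :
    ∑' k : ℕ, 1 / (Real.exp ((((⌈(8 : ℝ) / α⌉₊ + 1 + k : ℕ) : ℝ)) * α ^ 2 / 4) - 1)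
      ≤ (8 / α ^ 2) * (1 / (Real.exp (2 * α) - 1))
        + Real.exp (-1) / (1 - Real.exp (-(α ^ 2) / 8)) := by
  have hα2 : 0 < α ^ 2 := by positivity
  set N := ⌈(8 : ℝ) / α⌉₊
  set M := ⌊(8 : ℝ) / α ^ 2⌋₊
  have hN : 8 ≤ N * α := (div_le_iff₀ hα0).1 (Nat.le_ceil _)
  have hM : (M : ℝ) ≤ 8 / α ^ 2 := Nat.floor_le (by positivity)
  have hM' : 8 ≤ (M + 1 : ℝ) * α ^ 2 := (div_le_iff₀ hα2).1 (Nat.lt_floor_add_one _).le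
  set f : ℕ → ℝ := fun k => 1 / (Real.exp (((N + 1 + k : ℕ) : ℝ) * α ^ 2 / 4) - 1) with hf
  have hexp : 0 < Real.exp (2 * α) - 1 := by linarith [Real.add_one_le_exp (2 * α)]
  have hhead (k : ℕ) : f k ≤ 1 / (Real.exp (2 * α) - 1) := by
    apply one_div_le_one_div_of_le hexp
    gcongr
    push_cast
    have hk : 0 ≤ (1 + k : ℝ) * α ^ 2 := by positivity
    nlinarith
  set r := Real.exp (-(α ^ 2) / 8)
  have hr : r < 1 := Real.exp_lt_one_iff.2 (by linarith)
  have htail (i : ℕ) : f (i + M) ≤ Real.exp (-1) * r ^ i := by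
    have hi : 8 + i * α ^ 2 ≤ ((N + 1 + (i + M) : ℕ) : ℝ) * α ^ 2 := by
      push_cast
      have : 0 ≤ (N : ℝ) * α ^ 2 := by positivity
      linarith
    have hi0 : 0 ≤ (i : ℝ) * α ^ 2 := by positivity
    refine (one_div_exp_sub_one_le_exp_neg_half (by linarith)).trans ?_
    rw [← Real.exp_nat_mul, ← Real.exp_add]
    gcongr
    linarith
  have hf0 (k : ℕ) : 0 ≤ f k :=
    one_div_nonneg.2 (sub_nonneg.2 (Real.one_le_exp (by positivity)))
  have hgeom : HasSum (fun i : ℕ => Real.exp (-1) * r ^ i) (Real.exp (-1) / (1 - r)) :=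
    (hasSum_geometric_of_lt_one (Real.exp_nonneg _) hr).mul_left _
  have hsum : Summable fun i => f (i + M) :=
    Summable.of_nonneg_of_le (fun i => hf0 _) htail hgeom.summable
  rw [← ((summable_nat_add_iff M).1 hsum).sum_add_tsum_nat_add M]
  apply add_le_add
  · calc ∑ k ∈ Finset.range M, f k ≤ M * (1 / (Real.exp (2 * α) - 1)) := by
          simpa using Finset.sum_le_card_nsmul (Finset.range M) f _ fun k _ => hhead k
      _ ≤ _ := by gcongr
  · exact (hsum.tsum_le_tsum htail hgeom.summable).trans_eq hgeom.tsum_eq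
end

section
/- For every α ∈ (0, 1/2) and every integer j ≥ 2, setting R := (1/2 + α)/(1/2 − α), one has (1/2 − α)^j · 2^{j+1} · Σ_{s=0}^{⌊j/2⌋−1} (1 − 2s/(j+1)) · R^s ≤ (12/(j+1)) · (R/(R−1)²) · exp(−α²·j). -/
lemma sq_mul_sum_linear_mul_pow (a R : ℝ) (n : ℕ) :
    (R - 1) ^ 2 * ∑ s ∈ Finset.range n, (a - 2 * (s : ℝ)) * R ^ s =
      R ^ n * ((a - 2 * n) * (R - 1) + 2 * R) - (a * (R - 1) + 2 * R) := by
  induction n with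
  | zero => simp
  | succ n ih =>
    rw [Finset.sum_range_succ, mul_add, ih]
    push_cast
    ring

lemma pow_mul_odds_pow_le_exp {α : ℝ} (hα0 : 0 < α) (hα : α < 1 / 2) {j : ℕ} (hj : 2 ≤ j) :
    (1 - 2 * α) ^ j * ((1 / 2 + α) / (1 / 2 - α)) ^ (j / 2) ≤ Real.exp (-(α ^ 2) * j) := by
  have hd : 1 / 2 - α ≠ 0 := by linarith
  have hj4 : (j : ℝ) ≤ 4 * ((j / 2 : ℕ) : ℝ) := by
    have : j ≤ 4 * (j / 2) := by omega
    exact_mod_cast this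
  have hR0 : 0 ≤ (1 / 2 + α) / (1 / 2 - α) := div_nonneg (by linarith) (by linarith)
  calc (1 - 2 * α) ^ j * ((1 / 2 + α) / (1 / 2 - α)) ^ (j / 2)
      ≤ (1 - 2 * α) ^ (2 * (j / 2)) * ((1 / 2 + α) / (1 / 2 - α)) ^ (j / 2) :=
        mul_le_mul_of_nonneg_right
          (pow_le_pow_of_le_one (by linarith) (by linarith) (by omega)) (pow_nonneg hR0 _)
    _ = (1 - 4 * α ^ 2) ^ (j / 2) := by
        rw [pow_mul, ← mul_pow]
        congr 1
        rw [mul_div_assoc', div_eq_iff hd]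
        ring
    _ ≤ Real.exp (-(4 * α ^ 2)) ^ (j / 2) :=
        pow_le_pow_left₀ (by nlinarith) (Real.one_sub_le_exp_neg _) _
    _ = Real.exp (((j / 2 : ℕ) : ℝ) * -(4 * α ^ 2)) := (Real.exp_nat_mul _ _).symm
    _ ≤ Real.exp (-(α ^ 2) * j) := Real.exp_le_exp.2 (by nlinarith [sq_nonneg α])

theorem stmt_19 (α : ℝ) (hα0 : 0 < α) (hα : α < 1 / 2)
    (j : ℕ) (hj : 2 ≤ j) (R : ℝ) (hR : R = (1 / 2 + α) / (1 / 2 - α)) :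
    (1 / 2 - α) ^ j * 2 ^ (j + 1) *
        ∑ s ∈ Finset.range (j / 2), (1 - 2 * (s : ℝ) / ((j : ℝ) + 1)) * R ^ s
      ≤ (12 / ((j : ℝ) + 1)) * (R / (R - 1) ^ 2) * Real.exp (-(α ^ 2) * j) := by
  have hR1 : 1 < R := by
    rw [hR, one_lt_div (by linarith)]
    linarith
  have hexp := pow_mul_odds_pow_le_exp hα0 hα hj
  rw [← hR] at hexp
  have hj0 : (0 : ℝ) < (j : ℝ) + 1 := by positivity
  have hsq : 0 < (R - 1) ^ 2 := pow_pos (by linarith) 2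
  have hm : (j : ℝ) + 1 - 2 * ((j / 2 : ℕ) : ℝ) ≤ 2 := by
    have : j ≤ 2 * (j / 2) + 1 := by omega
    have : (j : ℝ) ≤ 2 * ((j / 2 : ℕ) : ℝ) + 1 := by exact_mod_cast this
    linarith
  have hsum : ∑ s ∈ Finset.range (j / 2), (1 - 2 * (s : ℝ) / ((j : ℝ) + 1)) * R ^ s =
      (∑ s ∈ Finset.range (j / 2), ((j : ℝ) + 1 - 2 * (s : ℝ)) * R ^ s) / ((j : ℝ) + 1) := by
    rw [Finset.sum_div]
    refine Finset.sum_congr rfl fun s _ => ?_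
    field_simp
  have hS : ∑ s ∈ Finset.range (j / 2), ((j : ℝ) + 1 - 2 * (s : ℝ)) * R ^ s ≤
      R ^ (j / 2) * (6 * R) / (R - 1) ^ 2 := by
    rw [le_div_iff₀' hsq, sq_mul_sum_linear_mul_pow]
    have h0 : 0 ≤ ((j : ℝ) + 1) * (R - 1) + 2 * R :=
      add_nonneg (mul_nonneg hj0.le (by linarith)) (by linarith)
    have h1 : R ^ (j / 2) * (((j : ℝ) + 1 - 2 * ((j / 2 : ℕ) : ℝ)) * (R - 1) + 2 * R) ≤
        R ^ (j / 2) * (6 * R) :=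
      mul_le_mul_of_nonneg_left (by nlinarith) (pow_nonneg (by linarith) _)
    linarith
  have hpow : (1 / 2 - α) ^ j * 2 ^ (j + 1) = 2 * (1 - 2 * α) ^ j := by
    rw [pow_succ, ← mul_assoc, ← mul_pow]
    ring
  have hb : 0 ≤ 1 - 2 * α := by linarith
  rw [hsum, hpow]
  calc _ ≤ 2 * (1 - 2 * α) ^ j * (R ^ (j / 2) * (6 * R) / (R - 1) ^ 2 / ((j : ℝ) + 1)) := by
        gcongr
    _ = (12 / ((j : ℝ) + 1)) * (R / (R - 1) ^ 2) * ((1 - 2 * α) ^ j * R ^ (j / 2)) := by ring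
    _ ≤ _ := by
        have : 0 ≤ R := by linarith
        gcongr
end
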